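/- Let q, v : ℝ → ℝ be differentiable functions and let K(x,λ) = λ + v(x) + q(x)/λ. For each integer n ≥ 0 define the function c̄_n(x,λ) = −K(x,λ)^{−n} · ∑_{k=0}^{n} (−1)^{k} s(n,k) · (log(λ·K(x,λ)))^{n−k+1} / (n−k+1)!, on the domain where λ > 0 and K(x,λ) > 0, and set c̄_{−1} := K. Then for every n ≥ 0 and every (x,λ) with λ > 0 and K(x,λ) > 0: {K, c̄_n}(x,λ) = ∂_x c̄_{n−1}(x,λ). (This is the order-by-order form in τ of the second half of Theorem 5.1: the conjugate series 𝕃̄₀ = K₀ + ∑_{n≥0} τ^{n+1} c̄_n satisfies the dispersionless Lax constraint {K₀, 𝕃̄₀} = τ ∂𝕃̄₀.) -/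

import Mathlib

/-- The dispersionless Poisson bracket of two functions `A, B` of `(x, λ)`:
`{A,B}(x,λ) = λ·∂_λA·∂_xB − ∂_xA·λ·∂_λB`. -/
noncomputable def poissonBracket (A B : ℝ → ℝ → ℝ) (x l : ℝ) : ℝ :=
  l * deriv (A x) l * deriv (fun y => B y l) x -
    deriv (fun y => A y l) x * (l * deriv (B x) l)

/-- The dispersionless Lax symbol `K(x,λ) = λ + v(x) + q(x)/λ`. -/
noncomputable def laxSymbol (q v : ℝ → ℝ) (x l : ℝ) : ℝ := l + v x + q x / l

/-- The unsigned Stirling number of the first kind `s(n,k)`, defined as the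
coefficient of `X^k` in the ascending factorial `X(X+1)⋯(X+n-1)`. -/
noncomputable def stirlingFirst (n k : ℕ) : ℚ := (ascPochhammer ℚ n).coeff k

/-- The coefficient of `τ^{n+1}` in the conjugate dispersionless Lax operator
`𝕃̄₀`:
`c̄_n(x,λ) = −K(x,λ)^{−n} ∑_{k=0}^{n} (−1)^{k} s(n,k) log(λ·K(x,λ))^{n−k+1}/(n−k+1)!`. -/
noncomputable def laxCoeffBar (q v : ℝ → ℝ) (n : ℕ) (x l : ℝ) : ℝ :=
  -(laxSymbol q v x l ^ (-(n : ℤ)) *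
    ∑ k ∈ Finset.range (n + 1),
      (-1 : ℝ) ^ k * (stirlingFirst n k : ℝ) *
        Real.log (l * laxSymbol q v x l) ^ (n - k + 1) / ((n - k + 1).factorial : ℝ))

noncomputable def auxP (n : ℕ) (L : ℝ) : ℝ :=
  ∑ k ∈ Finset.range (n + 1),
      (-1 : ℝ) ^ k * (stirlingFirst n k : ℝ) * L ^ (n - k + 1) / ((n - k + 1).factorial : ℝ)

noncomputable def auxD (n : ℕ) (L : ℝ) : ℝ :=
  ∑ k ∈ Finset.range (n + 1),
      (-1 : ℝ) ^ k * (stirlingFirst n k : ℝ) * L ^ (n - k) / ((n - k).factorial : ℝ)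

lemma auxP_hasDerivAt (n : ℕ) (L : ℝ) : HasDerivAt (auxP n) (auxD n L) L := by
  unfold auxP auxD
  apply HasDerivAt.fun_sum
  intro k _
  have h := (((hasDerivAt_id L).fun_pow (n - k + 1)).const_mul
    ((-1 : ℝ) ^ k * (stirlingFirst n k : ℝ))).div_const ((n - k + 1).factorial : ℝ)
  refine h.congr_deriv ?_
  rw [Nat.factorial_succ]
  have h1 : ((n - k).factorial : ℝ) ≠ 0 := by positivity
  have h2 : (((n - k : ℕ) : ℝ) + 1) ≠ 0 := by positivity
  simp only [id, Nat.add_sub_cancel, Nat.cast_mul, Nat.cast_add, Nat.cast_one]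
  field_simp

lemma stirling_zero (m : ℕ) : stirlingFirst (m + 1) 0 = m * stirlingFirst m 0 := by
  unfold stirlingFirst
  rw [ascPochhammer_succ_right, mul_add, Polynomial.coeff_add, Polynomial.coeff_mul_X_zero,
    Polynomial.coeff_mul_natCast]
  ring

lemma stirling_succ (m k : ℕ) :
    stirlingFirst (m + 1) (k + 1) = stirlingFirst m k + m * stirlingFirst m (k + 1) := by
  unfold stirlingFirst
  rw [ascPochhammer_succ_right, mul_add, Polynomial.coeff_add, Polynomial.coeff_mul_X,
    Polynomial.coeff_mul_natCast]
  ring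

lemma stirling_top (m : ℕ) : stirlingFirst m (m + 1) = 0 := by
  unfold stirlingFirst
  apply Polynomial.coeff_eq_zero_of_natDegree_lt
  rw [ascPochhammer_natDegree]
  omega

lemma aux_rec (m : ℕ) (L : ℝ) : auxD (m + 1) L = m * auxP m L - auxD m L := by
  have hP : auxP m L = ∑ k ∈ Finset.range (m + 1 + 1),
      (-1 : ℝ) ^ k * (stirlingFirst m k : ℝ) * L ^ (m + 1 - k) / ((m + 1 - k).factorial : ℝ) := by
    rw [Finset.sum_range_succ, stirling_top]
    simp only [Rat.cast_zero, mul_zero, zero_mul, zero_div, add_zero]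
    unfold auxP
    refine Finset.sum_congr rfl fun k hk => ?_
    have : k ≤ m := by simpa [Nat.lt_succ_iff] using hk
    rw [show m + 1 - k = m - k + 1 by omega]
  rw [hP]
  unfold auxD
  rw [Finset.sum_range_succ', Finset.sum_range_succ' _ (m + 1), mul_add, Finset.mul_sum,
    add_sub_right_comm, ← Finset.sum_sub_distrib]
  congr 1
  · refine Finset.sum_congr rfl fun k _ => ?_
    rw [stirling_succ, Nat.add_sub_add_right]
    push_cast
    ring
  · rw [stirling_zero]
    push_cast
    ring

lemma aux_comp (n : ℕ) (k u : ℝ → ℝ) (k' u' t : ℝ) (hk : HasDerivAt k k' t)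
    (hu : HasDerivAt u u' t) (hk0 : k t ≠ 0) (hu0 : u t ≠ 0) :
    HasDerivAt (fun s => -(k s ^ (-(n : ℤ)) * auxP n (Real.log (u s))))
      (-(-(n : ℝ) * (k t ^ (-(n : ℤ)) / k t) * k' * auxP n (Real.log (u t)) +
        k t ^ (-(n : ℤ)) * (auxD n (Real.log (u t)) * (u' / u t)))) t := by
  have h1 := (hasDerivAt_zpow (-(n : ℤ)) (k t) (Or.inl hk0)).comp t hk
  have h2 := (auxP_hasDerivAt n (Real.log (u t))).comp t (hu.log hu0)
  refine (h1.mul h2).neg.congr_deriv ?_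
  simp only [Function.comp]
  rw [zpow_sub_one₀ hk0]
  push_cast
  ring

/-- order-by-order form in `τ` of the second half of Theorem
5.1: with `c̄_{−1} := K`, for every `n ≥ 0` and every point with `λ > 0` and
`K(x,λ) > 0`, one has `{K, c̄_n}(x,λ) = ∂_x c̄_{n−1}(x,λ)`. -/
theorem dispersionless_lax_recursion_bar (q v : ℝ → ℝ)
    (hq : Differentiable ℝ q) (hv : Differentiable ℝ v) :
    ∀ (n : ℕ) (x l : ℝ), 0 < l → 0 < laxSymbol q v x l →
      poissonBracket (laxSymbol q v) (fun y μ => laxCoeffBar q v n y μ) x l =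
        deriv (fun y =>
          if n = 0 then laxSymbol q v y l else laxCoeffBar q v (n - 1) y l) x := by
  intro n x l hl hK
  have hKx : HasDerivAt (fun y => laxSymbol q v y l) (deriv v x + deriv q x / l) x := by
    unfold laxSymbol
    exact (((hv x).hasDerivAt.const_add l)).add ((hq x).hasDerivAt.div_const l)
  have hKl : HasDerivAt (laxSymbol q v x) (1 - q x / l ^ 2) l := by
    unfold laxSymbol
    have := ((hasDerivAt_id l).add_const (v x)).add
      ((hasDerivAt_const l (q x)).div (hasDerivAt_id l) hl.ne')
    refine this.congr_deriv ?_
    simp only [id]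
    ring
  have hu0 : l * laxSymbol q v x l ≠ 0 := (mul_pos hl hK).ne'
  have hcx : ∀ m : ℕ, _ := fun m => aux_comp m (fun y => laxSymbol q v y l)
    (fun y => l * laxSymbol q v y l) _ _ x hKx (hKx.const_mul l) hK.ne' hu0
  have hcl := aux_comp n (laxSymbol q v x)
    (fun y => y * laxSymbol q v x y) _ _ l hKl ((hasDerivAt_id' l).mul hKl) hK.ne' hu0
  have hbr : poissonBracket (laxSymbol q v) (fun y μ => laxCoeffBar q v n y μ) x l =
      laxSymbol q v x l ^ (-(n : ℤ)) * auxD n (Real.log (l * laxSymbol q v x l)) *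
        (deriv v x + deriv q x / l) := by
    unfold poissonBracket
    have e1 : deriv (fun y => laxCoeffBar q v n y l) x = _ := (hcx n).deriv
    have e2 : deriv (fun μ => laxCoeffBar q v n x μ) l = _ := hcl.deriv
    rw [e1, e2, hKx.deriv, hKl.deriv]
    generalize laxSymbol q v x l ^ (-(n : ℤ)) = Z
    generalize auxD n _ = D
    generalize auxP n _ = P
    generalize deriv v x + deriv q x / l = a
    generalize 1 - q x / l ^ 2 = b
    generalize laxSymbol q v x l = K at *
    have := hK.ne'
    have := hl.ne'
    field_simp
    ring
  rw [hbr]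
  cases n with
  | zero =>
    simp only [if_true]
    rw [hKx.deriv]
    simp [auxD, stirlingFirst]
  | succ m =>
    simp only [Nat.add_eq_zero_iff, one_ne_zero, and_false, if_false, Nat.add_sub_cancel]
    have e1 : deriv (fun y => laxCoeffBar q v m y l) x = _ := (hcx m).deriv
    rw [e1, aux_rec]
    have hz : laxSymbol q v x l ^ (-((m + 1 : ℕ) : ℤ)) =
        laxSymbol q v x l ^ (-(m : ℤ)) / laxSymbol q v x l := by
      rw [show (-((m + 1 : ℕ) : ℤ)) = -(m : ℤ) - 1 by push_cast; ring, zpow_sub_one₀ hK.ne']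
      rfl
    rw [hz]
    generalize laxSymbol q v x l ^ (-(m : ℤ)) = Z
    generalize auxD m _ = D
    generalize auxP m _ = P
    generalize deriv v x + deriv q x / l = a
    generalize laxSymbol q v x l = K at *
    have := hK.ne'
    have := hl.ne'
    field_simp
    ring
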